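/- arXiv:2509.15054 — 3 statements merged into one kernel-verified Lean document; each statement's English description precedes it below -/
import Mathlib

section
/- For every integer n ≥ 2 and every integer k ≥ 1, the images under the quotient map P → R^{(k,0)} of the following monomials form a basis of R^{(k,0)} as a ℂ-vector space: (1) the monomials ∏_{ℓ} X(0,ℓ)^{α_ℓ} for α : Fin k → ℕ with ∑_ℓ α_ℓ ≤ n−1; (2) for each i ∈ Fin k, the monomials (∏_{ℓ ≥ i} X(0,ℓ)^{α_ℓ})·X(1,i) for α supported on {i, i+1, …, k−1} with ∑_ℓ α_ℓ ≤ n−1; (3) the monomials X(0,h)·X(1,i) for h < i in Fin k. -/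
open MvPolynomial

/-- The diagonal action of the rotation ρ (by 2π/n) of the dihedral group I₂(n)
on `k` sets of two variables. -/
noncomputable def sigmaRho (n k : ℕ) :
    MvPolynomial (Fin 2 × Fin k) ℂ →ₐ[ℂ] MvPolynomial (Fin 2 × Fin k) ℂ :=
  aeval fun v =>
    if v.1 = 0 then
      (Real.cos (2 * Real.pi / n) : ℂ) • X ((0 : Fin 2), v.2)
        - (Real.sin (2 * Real.pi / n) : ℂ) • X ((1 : Fin 2), v.2)
    else
      (Real.sin (2 * Real.pi / n) : ℂ) • X ((0 : Fin 2), v.2)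
        + (Real.cos (2 * Real.pi / n) : ℂ) • X ((1 : Fin 2), v.2)

/-- The diagonal action of the reflection φ of the dihedral group I₂(n). -/
noncomputable def sigmaPhi (k : ℕ) :
    MvPolynomial (Fin 2 × Fin k) ℂ →ₐ[ℂ] MvPolynomial (Fin 2 × Fin k) ℂ :=
  aeval fun v => if v.1 = 0 then X ((0 : Fin 2), v.2) else - X ((1 : Fin 2), v.2)

/-- The diagonal invariant ideal I^{(k,0)} of the dihedral group I₂(n). -/
noncomputable def dihedralIdeal (n k : ℕ) : Ideal (MvPolynomial (Fin 2 × Fin k) ℂ) :=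
  Ideal.span { p | sigmaRho n k p = p ∧ sigmaPhi k p = p ∧ constantCoeff p = 0 }

/-- The set of monomials of Theorem 1.4 (specialized to j = 0):
(1) ∏_ℓ X(0,ℓ)^{α_ℓ} with ∑ α ≤ n-1;
(2) (∏_{ℓ ≥ i} X(0,ℓ)^{α_ℓ}) · X(1,i) with α supported on {i,…,k-1} and ∑ α ≤ n-1;
(3) X(0,h) · X(1,i) with h < i. -/
def dihedralBasisSet (n k : ℕ) : Set (MvPolynomial (Fin 2 × Fin k) ℂ) :=
  { p | ∃ α : Fin k → ℕ, (∑ ℓ, α ℓ) ≤ n - 1 ∧ p = ∏ ℓ, X ((0 : Fin 2), ℓ) ^ α ℓ } ∪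
  { p | ∃ i : Fin k, ∃ α : Fin k → ℕ, (∀ ℓ, ℓ < i → α ℓ = 0) ∧ (∑ ℓ, α ℓ) ≤ n - 1 ∧
        p = (∏ ℓ, X ((0 : Fin 2), ℓ) ^ α ℓ) * X ((1 : Fin 2), i) } ∪
  { p | ∃ h i : Fin k, h < i ∧ p = X ((0 : Fin 2), h) * X ((1 : Fin 2), i) }

theorem prod_pow_add_single {R : Type*} [CommMonoid R] {k : ℕ} (x : Fin k → R)
    (α : Fin k → ℕ) (m : Fin k) :
    ∏ ℓ, x ℓ ^ (α + Pi.single m 1 : Fin k → ℕ) ℓ = (∏ ℓ, x ℓ ^ α ℓ) * x m := by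
  simp only [Pi.add_apply, pow_add, Finset.prod_mul_distrib]
  congr 1
  rw [Finset.prod_eq_single m] <;> simp +contextual

theorem sum_add_single {k : ℕ} (α : Fin k → ℕ) (m : Fin k) :
    ∑ ℓ, (α + Pi.single m 1 : Fin k → ℕ) ℓ = (∑ ℓ, α ℓ) + 1 := by
  simp [Finset.sum_add_distrib]

theorem exists_eq_add_single {k : ℕ} {α : Fin k → ℕ} {m : Fin k} (h : α m ≠ 0) :
    ∃ β : Fin k → ℕ, α = β + Pi.single m 1 := by
  refine ⟨α - Pi.single m 1, ?_⟩
  ext ℓ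
  by_cases hl : ℓ = m
  · subst hl
    simp
    omega
  · simp [hl]

theorem exists_eq_add_single_of_sum_ne_zero {k : ℕ} {α : Fin k → ℕ} (h : ∑ ℓ, α ℓ ≠ 0) :
    ∃ (β : Fin k → ℕ) (m : Fin k), α = β + Pi.single m 1 := by
  obtain ⟨m, -, hm⟩ := Finset.exists_ne_zero_of_sum_ne_zero h
  obtain ⟨β, hβ⟩ := exists_eq_add_single hm
  exact ⟨β, m, hβ⟩

theorem eq_zero_of_sum_eq_zero {k : ℕ} {α : Fin k → ℕ} (h : ∑ ℓ, α ℓ = 0) : α = 0 := by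
  ext ℓ
  simpa using (Finset.sum_eq_zero_iff.mp h) ℓ (Finset.mem_univ ℓ)

theorem mem_dihedralBasisSet_iff {n k : ℕ} (hn : 2 ≤ n) (p : MvPolynomial (Fin 2 × Fin k) ℂ) :
    p ∈ dihedralBasisSet n k ↔
      (∃ α : Fin k → ℕ, (∑ ℓ, α ℓ) < n ∧ p = ∏ ℓ, X ((0 : Fin 2), ℓ) ^ α ℓ) ∨
      ∃ (α : Fin k → ℕ) (i : Fin k), (∑ ℓ, α ℓ) < n ∧
        ((∀ ℓ, ℓ < i → α ℓ = 0) ∨ ∑ ℓ, α ℓ = 1) ∧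
        p = (∏ ℓ, X ((0 : Fin 2), ℓ) ^ α ℓ) * X ((1 : Fin 2), i) := by
  have key : ∀ h i : Fin k, (X ((0 : Fin 2), h) * X ((1 : Fin 2), i) :
      MvPolynomial (Fin 2 × Fin k) ℂ) =
      (∏ ℓ, X ((0 : Fin 2), ℓ) ^ (0 + Pi.single h 1 : Fin k → ℕ) ℓ) * X ((1 : Fin 2), i) := by
    intro h i
    rw [prod_pow_add_single]
    simp
  constructor
  · rintro ((⟨α, hα, rfl⟩ | ⟨i, α, hi, hα, rfl⟩) | ⟨h, i, hhi, rfl⟩)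
    · exact Or.inl ⟨α, by omega, rfl⟩
    · exact Or.inr ⟨α, i, by omega, Or.inl hi, rfl⟩
    · have hs := sum_add_single 0 h
      simp only [Pi.zero_apply, Finset.sum_const_zero] at hs
      exact Or.inr ⟨0 + Pi.single h 1, i, by omega, Or.inr (by omega), key h i⟩
  · rintro (⟨α, hα, rfl⟩ | ⟨α, i, hα, hi | h1, rfl⟩)
    · exact Or.inl (Or.inl ⟨α, by omega, rfl⟩)
    · exact Or.inl (Or.inr ⟨i, α, hi, by omega, rfl⟩)
    · obtain ⟨β, m, rfl⟩ := exists_eq_add_single_of_sum_ne_zero (α := α) (by omega)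
      obtain rfl : β = 0 := eq_zero_of_sum_eq_zero (by rw [sum_add_single] at h1; omega)
      by_cases hmi : m < i
      · exact Or.inr ⟨m, i, hmi, (key m i).symm⟩
      · refine Or.inl (Or.inr ⟨i, _, ?_, by omega, rfl⟩)
        intro ℓ hℓ
        have : ℓ ≠ m := by rintro rfl; exact hmi hℓ
        simp [this]

theorem isPrimitiveRoot_cos_add_sin {n : ℕ} (hn : n ≠ 0) {ε : ℂ}
    (hε : ε = Complex.I ∨ ε = -Complex.I) :
    IsPrimitiveRoot ((Real.cos (2 * Real.pi / n) : ℂ) + ε * (Real.sin (2 * Real.pi / n) : ℂ)) n := by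
  have h := Complex.isPrimitiveRoot_exp n hn
  have e : (2 * Real.pi * Complex.I / n : ℂ) = ((2 * Real.pi / n : ℝ) : ℂ) * Complex.I := by
    push_cast; ring
  rw [e] at h
  rcases hε with rfl | rfl
  · convert h using 1
    rw [Complex.exp_mul_I]
    push_cast; ring
  · have h' := h.inv
    rw [← Complex.exp_neg, ← neg_mul, Complex.exp_mul_I, Complex.cos_neg, Complex.sin_neg] at h'
    rwa [Complex.ofReal_cos, Complex.ofReal_sin, neg_mul_comm, mul_comm Complex.I]

section Spanning

variable {R : Type*} [CommRing R] {k : ℕ} {x y : Fin k → R}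

theorem swap_of_mul_add_mul_eq_zero (h : ∀ i j, x i * x j + y i * y j = 0) (i j l : Fin k) :
    x l * (x i * y j) = x l * (x j * y i) := by
  linear_combination y j * h l i - y i * h l j

variable [Algebra ℂ R]

theorem prod_add_prod_eq_prod {z w : Fin k → R} (h : ∀ i j, z i * w j + w i * z j = 0)
    (α : Fin k → ℕ) (hα : ∑ ℓ, α ℓ ≠ 0) :
    ∏ ℓ, z ℓ ^ α ℓ + ∏ ℓ, w ℓ ^ α ℓ = ∏ ℓ, (z ℓ + w ℓ) ^ α ℓ := by
  have half : ∀ a : R, a + a = 0 → a = 0 := by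
    intro a ha
    have h2 : (2 : ℂ) • a = 0 := by rw [two_smul, ha]
    exact (smul_eq_zero_iff_right (two_ne_zero)).mp h2
  have hzzw : ∀ i j l, z i * z j * w l = 0 := by
    intro i j l
    apply half
    linear_combination z i * h j l + z j * h i l - z l * h j i
  have hwwz : ∀ i j l, w i * w j * z l = 0 := by
    intro i j l
    apply half
    linear_combination w i * h j l + w j * h i l - w l * h j i
  obtain ⟨d, hd⟩ : ∃ d, ∑ ℓ, α ℓ = d + 1 := Nat.exists_eq_succ_of_ne_zero hα
  clear hα
  induction d generalizing α with
  | zero =>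
    obtain ⟨β, m, rfl⟩ := exists_eq_add_single_of_sum_ne_zero (α := α) (by omega)
    rw [sum_add_single] at hd
    obtain rfl : β = 0 := eq_zero_of_sum_eq_zero (by omega)
    simp only [prod_pow_add_single]
    simp
  | succ d ih =>
    obtain ⟨β, m, rfl⟩ := exists_eq_add_single_of_sum_ne_zero (α := α) (by omega)
    rw [sum_add_single] at hd
    have hβ := ih β (by omega)
    rw [prod_pow_add_single, prod_pow_add_single, prod_pow_add_single, ← hβ]
    obtain ⟨γ, l, rfl⟩ := exists_eq_add_single_of_sum_ne_zero (α := β) (by omega)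
    rw [prod_pow_add_single, prod_pow_add_single]
    by_cases hγ : ∑ ℓ, γ ℓ = 0
    · rw [eq_zero_of_sum_eq_zero hγ]
      simp only [Pi.zero_apply, pow_zero, Finset.prod_const_one]
      linear_combination - h l m
    · obtain ⟨δ, p, rfl⟩ := exists_eq_add_single_of_sum_ne_zero hγ
      rw [prod_pow_add_single, prod_pow_add_single]
      linear_combination - (∏ ℓ, z ℓ ^ δ ℓ) * hzzw p l m - (∏ ℓ, w ℓ ^ δ ℓ) * hwwz p l m

theorem prod_pow_eq_zero_of_le_sum {n : ℕ} (hn : n ≠ 0)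
    (h : ∀ i j, x i * x j + y i * y j = 0)
    (hinv : ∀ α : Fin k → ℕ, ∑ ℓ, α ℓ = n →
      ∏ ℓ, (x ℓ + Complex.I • y ℓ) ^ α ℓ + ∏ ℓ, (x ℓ + (-Complex.I) • y ℓ) ^ α ℓ = 0)
    (α : Fin k → ℕ) (hα : n ≤ ∑ ℓ, α ℓ) : ∏ ℓ, x ℓ ^ α ℓ = 0 := by
  obtain ⟨d, hd⟩ := Nat.exists_eq_add_of_le hα
  induction d generalizing α with
  | zero =>
    have hz := hinv α hd
    rw [prod_add_prod_eq_prod _ α (by omega)] at hz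
    · have e : ∀ ℓ, (x ℓ + Complex.I • y ℓ) + (x ℓ + (-Complex.I) • y ℓ) = (2 : ℂ) • x ℓ := by
        intro ℓ
        rw [neg_smul, two_smul]
        ring
      simp only [e, smul_pow, Finset.prod_smul] at hz
      rwa [smul_eq_zero_iff_right] at hz
      exact Finset.prod_ne_zero_iff.mpr fun _ _ => pow_ne_zero _ two_ne_zero
    · intro i j
      have hI : algebraMap ℂ R Complex.I * algebraMap ℂ R Complex.I = -1 := by
        rw [← map_mul, Complex.I_mul_I, map_neg, map_one]
      simp only [Algebra.smul_def, map_neg]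
      linear_combination 2 * h i j - 2 * y i * y j * hI
  | succ d ih =>
    obtain ⟨β, m, rfl⟩ := exists_eq_add_single_of_sum_ne_zero (α := α) (by omega)
    rw [sum_add_single] at hd
    rw [prod_pow_add_single, ih β (by omega) (by omega), zero_mul]

theorem prod_pow_mul_mem_of_relations {n : ℕ} (h : ∀ i j, x i * x j + y i * y j = 0)
    (hx : ∀ α : Fin k → ℕ, n ≤ ∑ ℓ, α ℓ → ∏ ℓ, x ℓ ^ α ℓ = 0) (W : Submodule ℂ R)
    (hW : ∀ (α : Fin k → ℕ) (i : Fin k), ∑ ℓ, α ℓ < n →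
      ((∀ ℓ, ℓ < i → α ℓ = 0) ∨ ∑ ℓ, α ℓ = 1) → (∏ ℓ, x ℓ ^ α ℓ) * y i ∈ W)
    (α : Fin k → ℕ) (i : Fin k) : (∏ ℓ, x ℓ ^ α ℓ) * y i ∈ W := by
  by_cases hα : n ≤ ∑ ℓ, α ℓ
  · rw [hx α hα, zero_mul]
    exact W.zero_mem
  by_cases hgood : (∀ ℓ, ℓ < i → α ℓ = 0) ∨ ∑ ℓ, α ℓ = 1
  · exact hW α i (by omega) hgood
  push Not at hgood hα
  obtain ⟨⟨ℓ, hℓi, hℓ⟩, h1⟩ := hgood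
  obtain ⟨m, hm, hmin⟩ := WellFounded.has_min (r := fun a b : Fin k => a < b) wellFounded_lt
    {l | α l ≠ 0} ⟨ℓ, hℓ⟩
  have hmi : m < i := lt_of_le_of_lt (not_lt.mp (hmin ℓ hℓ)) hℓi
  obtain ⟨β, rfl⟩ := exists_eq_add_single hm
  rw [sum_add_single] at h1 hα
  obtain ⟨γ, l, rfl⟩ := exists_eq_add_single_of_sum_ne_zero (α := β) (by omega)
  have e : (∏ ℓ, x ℓ ^ (γ + Pi.single l 1 + Pi.single m 1 : Fin k → ℕ) ℓ) * y i =
      (∏ ℓ, x ℓ ^ (γ + Pi.single l 1 + Pi.single i 1 : Fin k → ℕ) ℓ) * y m := by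
    rw [prod_pow_add_single, prod_pow_add_single, prod_pow_add_single _ _ i,
      prod_pow_add_single]
    linear_combination (∏ ℓ, x ℓ ^ γ ℓ) * swap_of_mul_add_mul_eq_zero h m i l
  rw [e]
  refine hW _ _ (by rwa [sum_add_single]) (Or.inl fun j hj => ?_)
  by_contra hne
  refine hmin j ?_ hj
  have hji : j ≠ i := (hj.trans hmi).ne
  simp only [Pi.add_apply, Pi.single_eq_of_ne hji, add_zero] at hne
  simp only [Set.mem_ofPred_eq, Pi.add_apply]
  omega

end Spanning

section Invariants

variable {n k : ℕ}

theorem sigmaRho_X_zero (ℓ : Fin k) : sigmaRho n k (X (0, ℓ)) =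
    (Real.cos (2 * Real.pi / n) : ℂ) • X (0, ℓ) - (Real.sin (2 * Real.pi / n) : ℂ) • X (1, ℓ) := by
  rw [sigmaRho, aeval_X, if_pos rfl]

theorem sigmaRho_X_one (ℓ : Fin k) : sigmaRho n k (X (1, ℓ)) =
    (Real.sin (2 * Real.pi / n) : ℂ) • X (0, ℓ) + (Real.cos (2 * Real.pi / n) : ℂ) • X (1, ℓ) := by
  rw [sigmaRho, aeval_X, if_neg one_ne_zero]

theorem sigmaPhi_X_zero (ℓ : Fin k) : sigmaPhi k (X (0, ℓ)) = X (0, ℓ) := by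
  rw [sigmaPhi, aeval_X, if_pos rfl]

theorem sigmaPhi_X_one (ℓ : Fin k) : sigmaPhi k (X (1, ℓ)) = -X (1, ℓ) := by
  rw [sigmaPhi, aeval_X, if_neg one_ne_zero]

theorem X_mul_X_add_X_mul_X_mem_dihedralIdeal (i j : Fin k) :
    (X (0, i) * X (0, j) + X (1, i) * X (1, j) : MvPolynomial (Fin 2 × Fin k) ℂ) ∈
      dihedralIdeal n k := by
  refine Ideal.subset_span ⟨?_, ?_, by simp⟩
  · have hcs : (C (Real.cos (2 * Real.pi / n) : ℂ) : MvPolynomial (Fin 2 × Fin k) ℂ) ^ 2 +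
        C (Real.sin (2 * Real.pi / n) : ℂ) ^ 2 = 1 := by
      rw [← map_pow, ← map_pow, ← map_add, ← map_one C]
      exact_mod_cast congrArg (fun r : ℝ => C (r : ℂ)) (Real.cos_sq_add_sin_sq (2 * Real.pi / n))
    simp only [map_add, map_mul, sigmaRho_X_zero, sigmaRho_X_one, smul_eq_C_mul]
    linear_combination (X (0, i) * X (0, j) + X (1, i) * X (1, j)) * hcs
  · simp only [map_add, map_mul, sigmaPhi_X_zero, sigmaPhi_X_one]
    ring

theorem prod_add_prod_mem_dihedralIdeal (hn : n ≠ 0) (α : Fin k → ℕ) (hα : ∑ ℓ, α ℓ = n) :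
    (∏ ℓ, (X (0, ℓ) + Complex.I • X (1, ℓ)) ^ α ℓ +
      ∏ ℓ, (X (0, ℓ) + (-Complex.I) • X (1, ℓ)) ^ α ℓ : MvPolynomial (Fin 2 × Fin k) ℂ) ∈
      dihedralIdeal n k := by
  refine Ideal.subset_span ⟨?_, ?_, ?_⟩
  · have key : ∀ ε : ℂ, ε = Complex.I ∨ ε = -Complex.I →
        sigmaRho n k (∏ ℓ, (X (0, ℓ) + ε • X (1, ℓ)) ^ α ℓ) =
          ∏ ℓ, (X (0, ℓ) + ε • X (1, ℓ)) ^ α ℓ := by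
      intro ε hε
      have hε2 : ε * ε = -1 := by
        rcases hε with rfl | rfl <;> simp
      have e : ∀ ℓ : Fin k, sigmaRho n k (X (0, ℓ) + ε • X (1, ℓ)) =
          ((Real.cos (2 * Real.pi / n) : ℂ) + ε * (Real.sin (2 * Real.pi / n) : ℂ)) •
            (X (0, ℓ) + ε • X (1, ℓ)) := by
        intro ℓ
        have hC : (C ε * C ε : MvPolynomial (Fin 2 × Fin k) ℂ) = -1 := by
          rw [← map_mul, hε2, map_neg, map_one]
        simp only [map_add, map_smul, sigmaRho_X_zero, sigmaRho_X_one]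
        simp only [smul_eq_C_mul, map_add, map_mul]
        linear_combination - C (Real.sin (2 * Real.pi / n) : ℂ) * X (1, ℓ) * hC
      simp only [map_prod, map_pow, e, smul_pow, Finset.prod_smul]
      rw [Finset.prod_pow_eq_pow_sum, hα, (isPrimitiveRoot_cos_add_sin hn hε).pow_eq_one, one_smul]
    rw [map_add, key _ (Or.inl rfl), key _ (Or.inr rfl)]
  · simp only [map_add, map_prod, map_pow, map_smul, sigmaPhi_X_zero, sigmaPhi_X_one, smul_neg,
      neg_smul, map_neg, neg_neg]
    rw [add_comm]
  · obtain ⟨β, m, rfl⟩ := exists_eq_add_single_of_sum_ne_zero (α := α) (by omega)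
    rw [prod_pow_add_single, prod_pow_add_single]
    simp [smul_eq_C_mul]

theorem span_mk_dihedralBasisSet (hn : 2 ≤ n) :
    Submodule.span ℂ
      (Ideal.Quotient.mk (dihedralIdeal n k) '' dihedralBasisSet n k) = ⊤ := by
  set W := Submodule.span ℂ (Ideal.Quotient.mk (dihedralIdeal n k) '' dihedralBasisSet n k)
  set π := Ideal.Quotient.mkₐ ℂ (dihedralIdeal n k)
  have hπ : ∀ p, p ∈ dihedralIdeal n k → π p = 0 := fun p hp => Ideal.Quotient.eq_zero_iff_mem.mpr hp
  have hquad : ∀ i j, π (X (0, i)) * π (X (0, j)) + π (X (1, i)) * π (X (1, j)) = 0 := by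
    intro i j
    rw [← map_mul, ← map_mul, ← map_add]
    exact hπ _ (X_mul_X_add_X_mul_X_mem_dihedralIdeal i j)
  have hvan : ∀ α : Fin k → ℕ, n ≤ ∑ ℓ, α ℓ → ∏ ℓ, π (X (0, ℓ)) ^ α ℓ = 0 := by
    refine prod_pow_eq_zero_of_le_sum (y := fun ℓ => π (X (1, ℓ))) (by omega) hquad
      fun α hα => ?_
    simp only [← map_smul, ← map_add, ← map_pow, ← map_prod]
    exact hπ _ (prod_add_prod_mem_dihedralIdeal (by omega) α hα)
  have hB : ∀ b ∈ dihedralBasisSet n k, π b ∈ W := fun b hb => Submodule.subset_span ⟨b, hb, rfl⟩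
  have hx : ∀ α : Fin k → ℕ, ∏ ℓ, π (X (0, ℓ)) ^ α ℓ ∈ W := by
    intro α
    by_cases hα : n ≤ ∑ ℓ, α ℓ
    · rw [hvan α hα]
      exact W.zero_mem
    · simp only [← map_pow, ← map_prod]
      exact hB _ ((mem_dihedralBasisSet_iff hn _).mpr (Or.inl ⟨α, by omega, rfl⟩))
  have hxy : ∀ (α : Fin k → ℕ) (i : Fin k),
      (∏ ℓ, π (X (0, ℓ)) ^ α ℓ) * π (X (1, i)) ∈ W := by
    refine prod_pow_mul_mem_of_relations (y := fun ℓ => π (X (1, ℓ))) hquad hvan W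
      fun α i hα h => ?_
    simp only [← map_pow, ← map_prod, ← map_mul]
    exact hB _ ((mem_dihedralBasisSet_iff hn _).mpr (Or.inr ⟨α, i, hα, h, rfl⟩))
  have hmul : ∀ r ∈ W, ∀ v, r * π (X v) ∈ W := by
    intro r hr v
    induction hr using Submodule.span_induction with
    | zero => simp
    | add a b _ _ ha hb => rw [add_mul]; exact W.add_mem ha hb
    | smul c a _ ha => rw [smul_mul_assoc]; exact W.smul_mem c ha
    | mem r hr =>
      obtain ⟨b, hb, rfl⟩ := hr
      change π b * _ ∈ W
      obtain ⟨e, j⟩ := v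
      rcases (mem_dihedralBasisSet_iff hn b).mp hb with ⟨α, -, rfl⟩ | ⟨α, i, -, -, rfl⟩
      · simp only [map_prod, map_pow]
        fin_cases e
        · change _ * π (X (0, j)) ∈ W
          rw [← prod_pow_add_single (fun ℓ => π (X (0, ℓ)))]
          exact hx _
        · exact hxy α j
      · simp only [map_mul, map_prod, map_pow]
        fin_cases e
        · change _ * π (X (0, j)) ∈ W
          rw [mul_right_comm, ← prod_pow_add_single (fun ℓ => π (X (0, ℓ)))]
          exact hxy _ i
        · change _ * π (X (1, j)) ∈ W
          have e : (∏ ℓ, π (X (0, ℓ)) ^ α ℓ) * π (X (1, i)) * π (X (1, j)) =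
              -((∏ ℓ, π (X (0, ℓ)) ^ α ℓ) * π (X (0, i)) * π (X (0, j))) := by
            linear_combination (∏ ℓ, π (X (0, ℓ)) ^ α ℓ) * hquad i j
          rw [e, ← prod_pow_add_single (fun ℓ => π (X (0, ℓ))),
            ← prod_pow_add_single (fun ℓ => π (X (0, ℓ)))]
          exact W.neg_mem (hx _)
  rw [eq_top_iff]
  rintro r -
  obtain ⟨p, rfl⟩ := Ideal.Quotient.mk_surjective r
  change π p ∈ W
  induction p using MvPolynomial.induction_on with
  | C a =>
    have h1 := W.smul_mem a (hx 0)
    rw [← algebraMap_eq, AlgHom.commutes, Algebra.algebraMap_eq_smul_one]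
    simpa using h1
  | add p q hp hq => rw [map_add]; exact W.add_mem hp hq
  | mul_X p v hp => rw [map_mul]; exact hmul _ hp v

end Invariants

section ScaledRename

variable {σ τ : Type*} {R : Type*} [CommSemiring R]

theorem aeval_C_mul_X_monomial (a : σ → R) (f : σ → τ) (m : σ →₀ ℕ) (r : R) :
    aeval (fun v => C (a v) * X (f v) : σ → MvPolynomial τ R) (monomial m r) =
      monomial (m.mapDomain f) (r * m.prod fun v e => a v ^ e) := by
  rw [aeval_monomial, algebraMap_eq, Finsupp.prod]
  simp only [mul_pow, Finset.prod_mul_distrib, ← map_pow, ← map_prod]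
  rw [← mul_assoc, ← map_mul, monomial_eq, Finsupp.prod_mapDomain_index (by simp)
    (by simp [pow_add])]
  rfl

theorem coeff_aeval_C_mul_X (a : σ → R) (m : σ →₀ ℕ) (p : MvPolynomial σ R) :
    coeff m (aeval (fun v => C (a v) * X v : σ → MvPolynomial σ R) p) =
      (m.prod fun v e => a v ^ e) * coeff m p := by
  classical
  induction p using MvPolynomial.induction_on' with
  | monomial u r =>
    have h := aeval_C_mul_X_monomial a id u r
    simp only [id, Finsupp.mapDomain_id] at h
    rw [h, coeff_monomial, coeff_monomial]
    split_ifs with hu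
    · rw [hu, mul_comm]
    · rw [mul_zero]
  | add p q hp hq => rw [map_add, coeff_add, coeff_add, hp, hq, mul_add]

end ScaledRename

section Functionals

variable {n k : ℕ}

/-- The algebra map identifying `X (0, ℓ)` with `X ℓ` and `X (1, ℓ)` with `ε X ℓ`. -/
noncomputable def collapse (k : ℕ) (ε : ℂ) :
    MvPolynomial (Fin 2 × Fin k) ℂ →ₐ[ℂ] MvPolynomial (Fin k) ℂ :=
  aeval fun v => C (if v.1 = 0 then 1 else ε) * X v.2

theorem collapse_X_zero (ε : ℂ) (ℓ : Fin k) : collapse k ε (X (0, ℓ)) = X ℓ := by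
  rw [collapse, aeval_X, if_pos rfl, map_one, one_mul]

theorem collapse_X_one (ε : ℂ) (ℓ : Fin k) : collapse k ε (X (1, ℓ)) = C ε * X ℓ := by
  rw [collapse, aeval_X, if_neg one_ne_zero]

theorem prod_X_pow_eq_monomial_equivFunOnFinite {R : Type*} [CommSemiring R] (α : Fin k → ℕ) :
    ∏ ℓ, (X ℓ : MvPolynomial (Fin k) R) ^ α ℓ =
      monomial (Finsupp.equivFunOnFinite.symm α) 1 := by
  rw [monomial_eq, map_one, one_mul, Finsupp.prod_fintype _ _ (by simp)]
  rfl

theorem collapse_prod (ε : ℂ) (α : Fin k → ℕ) :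
    collapse k ε (∏ ℓ, X (0, ℓ) ^ α ℓ) = monomial (Finsupp.equivFunOnFinite.symm α) 1 := by
  simp only [map_prod, map_pow, collapse_X_zero]
  exact prod_X_pow_eq_monomial_equivFunOnFinite α

theorem collapse_prod_mul (ε : ℂ) (α : Fin k → ℕ) (i : Fin k) :
    collapse k ε ((∏ ℓ, X (0, ℓ) ^ α ℓ) * X (1, i)) =
      monomial (Finsupp.equivFunOnFinite.symm (α + Pi.single i 1)) ε := by
  rw [map_mul, collapse_prod, collapse_X_one, ← prod_X_pow_eq_monomial_equivFunOnFinite,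
    mul_left_comm, ← prod_pow_add_single, prod_X_pow_eq_monomial_equivFunOnFinite,
    C_mul_monomial, mul_one]

theorem collapse_sigmaPhi (ε : ℂ) (p : MvPolynomial (Fin 2 × Fin k) ℂ) :
    collapse k ε (sigmaPhi k p) = collapse k (-ε) p := by
  rw [← AlgHom.comp_apply]
  congr 1
  ext1 ⟨e, ℓ⟩
  fin_cases e
  · change collapse k ε (sigmaPhi k (X (0, ℓ))) = collapse k (-ε) (X (0, ℓ))
    rw [sigmaPhi_X_zero, collapse_X_zero, collapse_X_zero]
  · change collapse k ε (sigmaPhi k (X (1, ℓ))) = collapse k (-ε) (X (1, ℓ))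
    rw [sigmaPhi_X_one, map_neg, collapse_X_one, collapse_X_one, map_neg, neg_mul]

theorem collapse_sigmaRho {ε : ℂ} (hε : ε * ε = -1) (p : MvPolynomial (Fin 2 × Fin k) ℂ) :
    collapse k ε (sigmaRho n k p) =
      aeval (fun ℓ => C ((Real.cos (2 * Real.pi / n) : ℂ) + -ε * (Real.sin (2 * Real.pi / n) : ℂ)) *
        X ℓ) (collapse k ε p) := by
  have hC : (C ε * C ε : MvPolynomial (Fin k) ℂ) = -1 := by
    rw [← map_mul, hε, map_neg, map_one]
  rw [← AlgHom.comp_apply, ← AlgHom.comp_apply]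
  congr 1
  ext1 ⟨e, ℓ⟩
  rw [AlgHom.comp_apply, AlgHom.comp_apply]
  fin_cases e
  · change collapse k ε (sigmaRho n k (X (0, ℓ))) = aeval _ (collapse k ε (X (0, ℓ)))
    rw [sigmaRho_X_zero, map_sub, map_smul, map_smul, collapse_X_zero, collapse_X_one, aeval_X]
    simp only [smul_eq_C_mul, map_add, map_mul, map_neg]
    ring
  · change collapse k ε (sigmaRho n k (X (1, ℓ))) = aeval _ (collapse k ε (X (1, ℓ)))
    rw [sigmaRho_X_one, map_add, map_smul, map_smul, collapse_X_zero, collapse_X_one, map_mul,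
      aeval_X, ← algebraMap_eq, AlgHom.commutes, algebraMap_eq]
    simp only [smul_eq_C_mul, map_add, map_mul, map_neg]
    linear_combination C (Real.sin (2 * Real.pi / n) : ℂ) * X ℓ * hC

theorem coeff_collapse_eq_zero (hn : n ≠ 0) {ε : ℂ} (hε : ε = Complex.I ∨ ε = -Complex.I)
    {p : MvPolynomial (Fin 2 × Fin k) ℂ} (hρ : sigmaRho n k p = p) (h0 : constantCoeff p = 0)
    {a : Fin k →₀ ℕ} (ha : a.degree < n) : coeff a (collapse k ε p) = 0 := by
  by_cases ha0 : a.degree = 0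
  · rw [Finsupp.degree_eq_zero_iff] at ha0
    have e : constantCoeff.comp (collapse k ε).toRingHom =
        constantCoeff := by
      ext v
      · simp
      · simp [collapse]
    have := RingHom.congr_fun e p
    rw [ha0, ← constantCoeff_eq]
    exact this.trans h0
  have hε2 : ε * ε = -1 := by
    rcases hε with rfl | rfl <;> simp
  have hε' : -ε = Complex.I ∨ -ε = -Complex.I := by
    rcases hε with rfl | rfl <;> simp
  have h := congrArg (coeff a) (collapse_sigmaRho (n := n) hε2 p)
  rw [hρ, coeff_aeval_C_mul_X, Finsupp.prod, Finset.prod_pow_eq_pow_sum] at h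
  have hne := (isPrimitiveRoot_cos_add_sin hn hε').pow_ne_one_of_pos_of_lt ha0 ha
  by_contra hne0
  exact hne (mul_right_cancel₀ hne0 (by rw [one_mul]; exact h.symm))

theorem coeff_single_collapse (ε : ℂ) (p : MvPolynomial (Fin 2 × Fin k) ℂ) (j : Fin k) :
    coeff (Finsupp.single j 1) (collapse k ε p) =
      coeff (Finsupp.single (0, j) 1) p + ε * coeff (Finsupp.single (1, j) 1) p := by
  classical
  induction p using MvPolynomial.induction_on' with
  | monomial u r =>
    rw [collapse, aeval_C_mul_X_monomial]
    simp only [coeff_monomial]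
    by_cases hu : u.degree = 1
    · obtain ⟨⟨e, ℓ⟩, rfl⟩ := Finsupp.range_single_one.ge hu
      beta_reduce
      rw [Finsupp.mapDomain_single, Finsupp.prod_single_index (by simp)]
      by_cases hl : ℓ = j
      · fin_cases e <;> simp [hl, mul_comm, Finsupp.single_left_inj]
      · simp [Finsupp.single_left_inj, hl]
    · have h1 : u.mapDomain Prod.snd ≠ Finsupp.single j 1 := by
        intro h
        apply hu
        rw [← Finsupp.degree_mapDomain Prod.snd, h, Finsupp.degree_single]
      have h2 : ∀ e : Fin 2, u ≠ Finsupp.single (e, j) 1 := by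
        rintro e rfl
        exact hu (Finsupp.degree_single _ _)
      rw [if_neg h1, if_neg (h2 0), if_neg (h2 1), mul_zero, add_zero]
  | add p q hp hq =>
    rw [map_add, coeff_add, coeff_add, coeff_add, hp, hq]
    ring

theorem coeff_eq_zero_of_sigmaPhi_eq {p : MvPolynomial (Fin 2 × Fin k) ℂ} (hφ : sigmaPhi k p = p)
    {m : Fin 2 × Fin k →₀ ℕ} (hm : Odd (∑ ℓ, m (1, ℓ))) : coeff m p = 0 := by
  have e : sigmaPhi k = aeval fun v => C (if v.1 = 0 then (1 : ℂ) else -1) * X v := by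
    ext1 ⟨e, ℓ⟩
    fin_cases e <;> simp [sigmaPhi]
  have h := congrArg (coeff m) hφ
  rw [e, coeff_aeval_C_mul_X, Finsupp.prod_fintype _ _ (by simp), Fintype.prod_prod_type,
    Fin.prod_univ_two] at h
  simp only [one_ne_zero, if_true, if_false, one_pow, Finset.prod_const_one, one_mul] at h
  rw [Finset.prod_pow_eq_pow_sum, hm.neg_one_pow] at h
  linear_combination - h / 2

theorem mem_dihedralIdeal_induction {φ : MvPolynomial (Fin 2 × Fin k) ℂ →ₗ[ℂ] ℂ}
    (h : ∀ m p, sigmaRho n k p = p → sigmaPhi k p = p → constantCoeff p = 0 → φ (m * p) = 0)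
    {f : MvPolynomial (Fin 2 × Fin k) ℂ} (hf : f ∈ dihedralIdeal n k) : φ f = 0 := by
  suffices H : ∀ m, φ (m * f) = 0 by simpa using H 1
  refine Submodule.span_induction (p := fun f _ => ∀ m, φ (m * f) = 0) ?_ ?_ ?_ ?_ hf
  · rintro p ⟨hρ, hφ, h0⟩ m
    exact h m p hρ hφ h0
  · simp
  · intro f g _ _ hf hg m
    rw [mul_add, map_add, hf, hg, add_zero]
  · intro a f _ hf m
    rw [smul_eq_mul, ← mul_assoc]
    exact hf _

theorem coeff_mul_eq_zero_of_degree_lt {σ R : Type*} [CommSemiring R] {q : MvPolynomial σ R} {d : ℕ}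
    (hq : ∀ a : σ →₀ ℕ, a.degree < d → coeff a q = 0) (m : MvPolynomial σ R) {a : σ →₀ ℕ}
    (ha : a.degree < d) : coeff a (m * q) = 0 := by
  classical
  rw [coeff_mul]
  refine Finset.sum_eq_zero fun x hx => ?_
  rw [← Finset.HasAntidiagonal.mem_antidiagonal.mp hx, map_add] at ha
  rw [hq _ (by omega), mul_zero]

theorem coeff_mul_eq_zero_of_degree_le {σ R : Type*} [CommSemiring R] {q m : MvPolynomial σ R}
    {d : ℕ} (hq : ∀ a : σ →₀ ℕ, a.degree < d → coeff a q = 0) (hm : constantCoeff m = 0)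
    {a : σ →₀ ℕ} (ha : a.degree ≤ d) : coeff a (m * q) = 0 := by
  classical
  rw [coeff_mul]
  refine Finset.sum_eq_zero fun x hx => ?_
  rw [← Finset.HasAntidiagonal.mem_antidiagonal.mp hx, map_add] at ha
  by_cases h0 : x.1.degree = 0
  · rw [(Finsupp.degree_eq_zero_iff _).mp h0, ← constantCoeff_eq, hm, zero_mul]
  · rw [hq _ (by omega), mul_zero]

theorem coeff_single_add_single_eq_zero (hn : 2 ≤ n) (j i : Fin k)
    {f : MvPolynomial (Fin 2 × Fin k) ℂ} (hf : f ∈ dihedralIdeal n k) :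
    coeff (Finsupp.single (0, j) 1 + Finsupp.single (1, i) 1) f = 0 := by
  classical
  refine mem_dihedralIdeal_induction
    (φ := lcoeff ℂ (Finsupp.single (0, j) 1 + Finsupp.single (1, i) 1)) ?_ hf
  intro m p hρ hφ h0
  rw [lcoeff_apply, coeff_mul]
  refine Finset.sum_eq_zero fun ⟨w, v⟩ hx => ?_
  have hwv := fun t => DFunLike.congr_fun (Finset.HasAntidiagonal.mem_antidiagonal.mp hx) t
  simp only [Finsupp.add_apply, Finsupp.single_apply, Prod.forall, Prod.mk.injEq,
    Fin.forall_fin_two, zero_ne_one, one_ne_zero, true_and, false_and, if_false, add_zero,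
    zero_add] at hwv
  obtain ⟨hw0, hw1⟩ := hwv
  have hv1 : ∀ ℓ, ℓ ≠ i → v (1, ℓ) = 0 := by
    intro ℓ hℓ
    have := hw1 ℓ
    rw [if_neg hℓ.symm] at this
    omega
  have hv0 : ∀ ℓ, ℓ ≠ j → v (0, ℓ) = 0 := by
    intro ℓ hℓ
    have := hw0 ℓ
    rw [if_neg hℓ.symm] at this
    omega
  have hi := hw1 i
  have hj := hw0 j
  rw [if_pos rfl] at hi hj
  have hv : coeff v p = 0 := by
    by_cases hvi : v (1, i) = 0
    · have hvs : v = Finsupp.single (0, j) (v (0, j)) := by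
        ext ⟨e, ℓ⟩
        fin_cases e
        · by_cases hℓ : ℓ = j
          · simp [hℓ]
          · simpa [Finsupp.single_apply, Ne.symm hℓ] using hv0 ℓ hℓ
        · by_cases hℓ : ℓ = i
          · simpa [Finsupp.single_apply, hℓ] using hvi
          · simpa [Finsupp.single_apply] using hv1 ℓ hℓ
      by_cases hvj : v (0, j) = 0
      · rw [hvs, hvj, Finsupp.single_zero, ← constantCoeff_eq, h0]
      · have h1 := coeff_single_collapse Complex.I p j
        rw [coeff_collapse_eq_zero (by omega) (Or.inl rfl) hρ h0
          (by rw [Finsupp.degree_single]; omega),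
          coeff_eq_zero_of_sigmaPhi_eq hφ (m := Finsupp.single (1, j) 1)
            (by simp [Finsupp.single_apply]), mul_zero, add_zero] at h1
        rw [hvs, show v (0, j) = 1 by omega]
        exact h1.symm
    · refine coeff_eq_zero_of_sigmaPhi_eq hφ ?_
      rw [Finset.sum_eq_single i (fun ℓ _ hℓ => hv1 ℓ hℓ) (by simp), show v (1, i) = 1 by omega]
      exact odd_one
  rw [hv, mul_zero]

theorem coeff_collapse_eq_zero_of_mem (hn : n ≠ 0) {ε : ℂ}
    (hε : ε = Complex.I ∨ ε = -Complex.I) {a : Fin k →₀ ℕ} (ha : a.degree < n)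
    {f : MvPolynomial (Fin 2 × Fin k) ℂ} (hf : f ∈ dihedralIdeal n k) :
    coeff a (collapse k ε f) = 0 := by
  refine mem_dihedralIdeal_induction
    (φ := lcoeff ℂ a ∘ₗ (collapse k ε).toLinearMap) ?_ hf
  intro m p hρ _ h0
  simp only [LinearMap.comp_apply, AlgHom.toLinearMap_apply, lcoeff_apply, map_mul]
  exact coeff_mul_eq_zero_of_degree_lt (fun _ => coeff_collapse_eq_zero hn hε hρ h0) _ ha

theorem coeff_collapse_I_eq_coeff_collapse_neg_I (hn : n ≠ 0) {a : Fin k →₀ ℕ}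
    (ha : a.degree ≤ n) {f : MvPolynomial (Fin 2 × Fin k) ℂ} (hf : f ∈ dihedralIdeal n k) :
    coeff a (collapse k Complex.I f) = coeff a (collapse k (-Complex.I) f) := by
  rw [← sub_eq_zero]
  refine mem_dihedralIdeal_induction
    (φ := lcoeff ℂ a ∘ₗ ((collapse k Complex.I).toLinearMap -
      (collapse k (-Complex.I)).toLinearMap)) ?_ hf
  intro m p hρ hφ h0
  simp only [LinearMap.comp_apply, LinearMap.sub_apply, AlgHom.toLinearMap_apply, lcoeff_apply,
    map_mul]
  have hp : collapse k (-Complex.I) p = collapse k Complex.I p := by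
    rw [← collapse_sigmaPhi, hφ]
  rw [hp, ← sub_mul]
  refine coeff_mul_eq_zero_of_degree_le
    (fun _ => coeff_collapse_eq_zero hn (Or.inl rfl) hρ h0) ?_ ha
  induction m using MvPolynomial.induction_on with
  | C c => simp [← algebraMap_eq]
  | add p q hp hq =>
    simp only [map_add, map_sub] at hp hq ⊢
    linear_combination hp + hq
  | mul_X p v hp => simp [collapse]

theorem exists_eq_monomial_of_mem_dihedralBasisSet (hn : 2 ≤ n)
    {b : MvPolynomial (Fin 2 × Fin k) ℂ} (hb : b ∈ dihedralBasisSet n k) :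
    ∃ u, b = monomial u 1 := by
  suffices b ∈ MonoidHom.mrange (monomialOneHom ℂ (Fin 2 × Fin k)) by
    obtain ⟨u, hu⟩ := this
    exact ⟨u.toAdd, hu.symm⟩
  have hX : ∀ v, X v ∈ MonoidHom.mrange (monomialOneHom ℂ (Fin 2 × Fin k)) :=
    fun v => ⟨Multiplicative.ofAdd (Finsupp.single v 1), rfl⟩
  rcases (mem_dihedralBasisSet_iff hn b).mp hb with ⟨α, -, rfl⟩ | ⟨α, i, -, -, rfl⟩
  · exact prod_mem fun ℓ _ => pow_mem (hX _) _
  · exact mul_mem (prod_mem fun ℓ _ => pow_mem (hX _) _) (hX _)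

theorem eq_of_add_single_eq_add_single {α β : Fin k → ℕ} {i j : Fin k}
    (hα : ∀ ℓ, ℓ < i → α ℓ = 0) (hβ : ∀ ℓ, ℓ < j → β ℓ = 0)
    (h : α + Pi.single i 1 = β + Pi.single j 1) : α = β ∧ i = j := by
  have hij : i = j := by
    rcases lt_trichotomy i j with hlt | rfl | hlt
    · have := congrFun h i
      simp [hβ i hlt, hlt.ne] at this
    · rfl
    · have := congrFun h j
      simp [hα j hlt, hlt.ne] at this
  subst hij
  exact ⟨add_right_cancel h, rfl⟩

theorem exists_dual_functional (hn : 2 ≤ n) {b : MvPolynomial (Fin 2 × Fin k) ℂ}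
    (hb : b ∈ dihedralBasisSet n k) :
    ∃ φ : MvPolynomial (Fin 2 × Fin k) ℂ →ₗ[ℂ] ℂ, (∀ f ∈ dihedralIdeal n k, φ f = 0) ∧
      φ b ≠ 0 ∧ ∀ b' ∈ dihedralBasisSet n k, b' ≠ b → φ b' = 0 := by
  classical
  rcases (mem_dihedralBasisSet_iff hn b).mp hb with ⟨α, hα, rfl⟩ | ⟨α, i, hα, hi, rfl⟩
  · refine ⟨lcoeff ℂ (Finsupp.equivFunOnFinite.symm α) ∘ₗ ((collapse k Complex.I).toLinearMap +
      (collapse k (-Complex.I)).toLinearMap), fun f hf => ?_, ?_, fun b' hb' hne => ?_⟩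
    · have hdeg : (Finsupp.equivFunOnFinite.symm α).degree < n := by
        rwa [Finsupp.degree_eq_sum]
      simp only [LinearMap.comp_apply, LinearMap.add_apply, AlgHom.toLinearMap_apply,
        lcoeff_apply, coeff_add]
      rw [coeff_collapse_eq_zero_of_mem (by omega) (Or.inl rfl) hdeg hf,
        coeff_collapse_eq_zero_of_mem (by omega) (Or.inr rfl) hdeg hf, add_zero]
    · simp only [LinearMap.comp_apply, LinearMap.add_apply, AlgHom.toLinearMap_apply,
        lcoeff_apply, coeff_add, collapse_prod, coeff_monomial, if_true]
      norm_num
    · simp only [LinearMap.comp_apply, LinearMap.add_apply, AlgHom.toLinearMap_apply,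
        lcoeff_apply, coeff_add]
      rcases (mem_dihedralBasisSet_iff hn b').mp hb' with ⟨β, -, rfl⟩ | ⟨β, j, -, -, rfl⟩
      · have hβ : Finsupp.equivFunOnFinite.symm β ≠ Finsupp.equivFunOnFinite.symm α := by
          intro h
          rw [Finsupp.equivFunOnFinite.symm.injective h] at hne
          exact hne rfl
        simp only [collapse_prod, coeff_monomial, if_neg hβ, add_zero]
      · simp only [collapse_prod_mul, coeff_monomial]
        split_ifs <;> simp
  by_cases h1 : ∑ ℓ, α ℓ = 1
  · obtain ⟨β, j, rfl⟩ := exists_eq_add_single_of_sum_ne_zero (α := α) (by omega)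
    obtain rfl : β = 0 := eq_zero_of_sum_eq_zero (by rw [sum_add_single] at h1; omega)
    have e : (∏ ℓ, X ((0 : Fin 2), ℓ) ^ (0 + Pi.single j 1 : Fin k → ℕ) ℓ) * X ((1 : Fin 2), i) =
        (monomial (Finsupp.single (0, j) 1 + Finsupp.single (1, i) 1) 1 :
          MvPolynomial (Fin 2 × Fin k) ℂ) := by
      rw [prod_pow_add_single (fun ℓ => X ((0 : Fin 2), ℓ))]
      simp [X, monomial_mul]
    rw [e]
    refine ⟨lcoeff ℂ (Finsupp.single (0, j) 1 + Finsupp.single (1, i) 1),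
      fun f hf => coeff_single_add_single_eq_zero hn j i hf, ?_, fun b' hb' hne => ?_⟩
    · simp only [lcoeff_apply, coeff_monomial, if_true]
      exact one_ne_zero
    · obtain ⟨u, rfl⟩ := exists_eq_monomial_of_mem_dihedralBasisSet hn hb'
      rw [lcoeff_apply, coeff_monomial, if_neg]
      rintro rfl
      exact hne rfl
  · have hi' := hi.resolve_right h1
    refine ⟨lcoeff ℂ (Finsupp.equivFunOnFinite.symm (α + Pi.single i 1)) ∘ₗ
      ((collapse k Complex.I).toLinearMap - (collapse k (-Complex.I)).toLinearMap),
      fun f hf => ?_, ?_, fun b' hb' hne => ?_⟩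
    · have hdeg : (Finsupp.equivFunOnFinite.symm (α + Pi.single i 1)).degree ≤ n := by
        rw [Finsupp.degree_eq_sum]
        exact (sum_add_single α i).trans_le hα
      simp only [LinearMap.comp_apply, LinearMap.sub_apply, AlgHom.toLinearMap_apply,
        lcoeff_apply, coeff_sub]
      rw [coeff_collapse_I_eq_coeff_collapse_neg_I (by omega) hdeg hf, sub_self]
    · simp only [LinearMap.comp_apply, LinearMap.sub_apply, AlgHom.toLinearMap_apply,
        lcoeff_apply, coeff_sub, collapse_prod_mul, coeff_monomial, if_true]
      rw [sub_neg_eq_add, ← two_mul]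
      exact mul_ne_zero two_ne_zero Complex.I_ne_zero
    · simp only [LinearMap.comp_apply, LinearMap.sub_apply, AlgHom.toLinearMap_apply,
        lcoeff_apply, coeff_sub]
      rcases (mem_dihedralBasisSet_iff hn b').mp hb' with ⟨β, -, rfl⟩ | ⟨β, j, -, hj, rfl⟩
      · rw [collapse_prod, collapse_prod, sub_self]
      · have hβ : Finsupp.equivFunOnFinite.symm (β + Pi.single j 1) ≠
            Finsupp.equivFunOnFinite.symm (α + Pi.single i 1) := by
          intro h
          have h' := Finsupp.equivFunOnFinite.symm.injective h
          have hsum := congrArg (fun γ : Fin k → ℕ => ∑ ℓ, γ ℓ) h'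
          simp only [sum_add_single] at hsum
          have hj' := hj.resolve_right (by omega)
          obtain ⟨rfl, rfl⟩ := eq_of_add_single_eq_add_single hj' hi' h'
          exact hne rfl
        simp only [collapse_prod_mul, coeff_monomial, if_neg hβ, sub_self]

theorem linearIndependent_mk_dihedralBasisSet (hn : 2 ≤ n) :
    LinearIndependent ℂ
      (fun p : dihedralBasisSet n k =>
        Ideal.Quotient.mk (dihedralIdeal n k) (p : MvPolynomial (Fin 2 × Fin k) ℂ)) := by
  rw [linearIndependent_iff']
  intro s g hg b hbs
  obtain ⟨φ, hI, hb, hb'⟩ := exists_dual_functional hn b.2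
  have hmem : ∑ c ∈ s, g c • (c : MvPolynomial (Fin 2 × Fin k) ℂ) ∈ dihedralIdeal n k := by
    rw [← Ideal.Quotient.eq_zero_iff_mem, map_sum]
    exact hg
  have hφ := hI _ hmem
  rw [map_sum, Finset.sum_eq_single_of_mem b hbs, map_smul, smul_eq_mul] at hφ
  · exact (mul_eq_zero.mp hφ).resolve_right hb
  · intro c _ hcb
    rw [map_smul, hb' c c.2 fun h => hcb (Subtype.ext h), smul_zero]

end Functionals

theorem dihedral_monomial_basis (n k : ℕ) (hn : 2 ≤ n) (hk : 1 ≤ k) :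
    LinearIndependent ℂ
      (fun p : dihedralBasisSet n k =>
        Ideal.Quotient.mk (dihedralIdeal n k) (p : MvPolynomial (Fin 2 × Fin k) ℂ)) ∧
    Submodule.span ℂ
      (Ideal.Quotient.mk (dihedralIdeal n k) '' dihedralBasisSet n k) = ⊤ := by
  exact ⟨linearIndependent_mk_dihedralBasisSet hn, span_mk_dihedralBasisSet hn⟩
end

section
/- For every integer n ≥ 2 and every integer k ≥ 1: (a) for all indices h ≤ i in Fin k, the polynomial X(0,h)·X(0,i) + X(1,h)·X(1,i) lies in the diagonal invariant ideal I^{(k,0)}; and (b) for every α : Fin k → ℕ with ∑_ℓ α_ℓ = n, the monomial ∏_ℓ X(0,ℓ)^{α_ℓ} lies in I^{(k,0)}. -/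
open MvPolynomial

section PolarizedProducts

variable {R ι : Type*} [CommRing R] {I : Ideal R} {z w : ι → R}

theorem mul_mul_mem_of_polarized_mem (h2 : IsUnit (2 : R))
    (h : ∀ a b, z a * w b + w a * z b ∈ I) (a b c : ι) : z a * z b * w c ∈ I := by
  rw [← Ideal.unit_mul_mem_iff_mem I h2]
  have key : 2 * (z a * z b * w c) = z a * (z b * w c + w b * z c)
      - z c * (z a * w b + w a * z b) + z b * (z a * w c + w a * z c) := by ring
  rw [key]
  exact I.add_mem (I.sub_mem (I.mul_mem_left _ (h b c)) (I.mul_mem_left _ (h a b)))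
    (I.mul_mem_left _ (h a c))

theorem mul_prod_mem_of_polarized_mem (h2 : IsUnit (2 : R))
    (h : ∀ a b, z a * w b + w a * z b ∈ I) (c : ι) (s : Multiset ι) (hs : 2 ≤ s.card) :
    w c * (s.map z).prod ∈ I := by
  obtain ⟨a, ha⟩ := Multiset.card_pos_iff_exists_mem.1 (by omega : 0 < s.card)
  obtain ⟨t, rfl⟩ := Multiset.exists_cons_of_mem ha
  rw [Multiset.card_cons] at hs
  obtain ⟨b, hb⟩ := Multiset.card_pos_iff_exists_mem.1 (by omega : 0 < t.card)
  obtain ⟨u, rfl⟩ := Multiset.exists_cons_of_mem hb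
  simp only [Multiset.map_cons, Multiset.prod_cons]
  have := I.mul_mem_right (u.map z).prod (mul_mul_mem_of_polarized_mem h2 h a b c)
  convert this using 1
  ring

theorem prod_add_sub_prod_mem_of_polarized_mem (h2 : IsUnit (2 : R))
    (h : ∀ a b, z a * w b + w a * z b ∈ I) (s : Multiset ι) (hs : 2 ≤ s.card) :
    (s.map fun a => z a + w a).prod - ((s.map z).prod + (s.map w).prod) ∈ I := by
  induction s using Multiset.induction_on with
  | empty => simp at hs
  | cons a s ih =>
    rw [Multiset.card_cons] at hs
    simp only [Multiset.map_cons, Multiset.prod_cons]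
    rcases (by omega : s.card = 1 ∨ 2 ≤ s.card) with h1 | hs
    · obtain ⟨b, rfl⟩ := Multiset.card_eq_one.1 h1
      simp only [Multiset.map_singleton, Multiset.prod_singleton]
      convert h a b using 1
      ring
    · have hw := mul_prod_mem_of_polarized_mem h2 h a s hs
      have hz := mul_prod_mem_of_polarized_mem (z := w) (w := z) h2
        (fun a b => by rw [add_comm]; exact h a b) a s hs
      convert I.add_mem (I.mul_mem_left (z a + w a) (ih hs)) (I.add_mem hw hz) using 1
      ring

end PolarizedProducts

/-- The linear form `x₁ + u x₂` in the `ℓ`-th set of variables. -/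
noncomputable def linearForm {k : ℕ} (u : ℂ) (ℓ : Fin k) : MvPolynomial (Fin 2 × Fin k) ℂ :=
  X (0, ℓ) + C u * X (1, ℓ)

theorem sigmaRho_linearForm (n : ℕ) {k : ℕ} {u : ℂ} (hu : u * u = -1) (ℓ : Fin k) :
    sigmaRho n k (linearForm u ℓ) =
      C (Real.cos (2 * Real.pi / n) + Real.sin (2 * Real.pi / n) * u) * linearForm u ℓ := by
  have hC : (C u * C u : MvPolynomial (Fin 2 × Fin k) ℂ) = -1 := by
    rw [← C_mul, hu, C_neg, C_1]
  simp only [linearForm, sigmaRho, map_add, map_mul, aeval_X, algHom_C, algebraMap_eq,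
    smul_eq_C_mul, if_true, one_ne_zero, if_false]
  linear_combination (-C (Real.sin (2 * Real.pi / n) : ℂ) * X (1, ℓ)) * hC

theorem sigmaPhi_linearForm {k : ℕ} (u : ℂ) (ℓ : Fin k) :
    sigmaPhi k (linearForm u ℓ) = linearForm (-u) ℓ := by
  simp [linearForm, sigmaPhi, algHom_C]

theorem cos_add_sin_mul_pow_eq_one {n : ℕ} (hn : n ≠ 0) {u : ℂ} (hu : u * u = -1) :
    ((Real.cos (2 * Real.pi / n) : ℂ) + Real.sin (2 * Real.pi / n) * u) ^ n = 1 := by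
  have hn' : (n : ℂ) ≠ 0 := Nat.cast_ne_zero.2 hn
  have hI : ((Real.cos (2 * Real.pi / n) : ℂ) + Real.sin (2 * Real.pi / n) * Complex.I) ^ n
      = 1 := by
    push_cast
    rw [Complex.cos_add_sin_mul_I_pow, mul_div_cancel₀ _ hn']
    simp
  rcases mul_self_eq_mul_self_iff.1 (hu.trans Complex.I_mul_I.symm) with rfl | rfl
  · exact hI
  · simpa only [map_pow, map_add, map_mul, Complex.conj_ofReal, Complex.conj_I, map_one]
      using congrArg (starRingEnd ℂ) hI

theorem sigmaRho_prod_linearForm {n k : ℕ} (hn : n ≠ 0) {u : ℂ} (hu : u * u = -1)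
    (s : Multiset (Fin k)) (hs : s.card = n) :
    sigmaRho n k (s.map (linearForm u)).prod = (s.map (linearForm u)).prod := by
  rw [map_multiset_prod, Multiset.map_map]
  simp only [Function.comp_def, sigmaRho_linearForm n hu, Multiset.prod_map_mul,
    Multiset.map_const', Multiset.prod_replicate, hs]
  rw [← C_pow, cos_add_sin_mul_pow_eq_one hn hu, C_1, one_mul]

theorem sigmaPhi_prod_linearForm {k : ℕ} (u : ℂ) (s : Multiset (Fin k)) :
    sigmaPhi k (s.map (linearForm u)).prod = (s.map (linearForm (-u))).prod := by
  rw [map_multiset_prod, Multiset.map_map]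
  simp only [Function.comp_def, sigmaPhi_linearForm]

theorem constantCoeff_prod_linearForm {k : ℕ} (u : ℂ) (s : Multiset (Fin k)) (hs : s ≠ 0) :
    constantCoeff (s.map (linearForm u)).prod = 0 := by
  obtain ⟨a, ha⟩ := Multiset.exists_mem_of_ne_zero hs
  obtain ⟨t, rfl⟩ := Multiset.exists_cons_of_mem ha
  simp [linearForm]

theorem prod_linearForm_add_mem_dihedralIdeal {n k : ℕ} (hn : n ≠ 0) (s : Multiset (Fin k))
    (hs : s.card = n) :
    (s.map (linearForm Complex.I)).prod + (s.map (linearForm (-Complex.I))).prod ∈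
      dihedralIdeal n k := by
  have hs0 : s ≠ 0 := by
    rintro rfl
    exact hn hs.symm
  refine Ideal.subset_span ⟨?_, ?_, ?_⟩
  · rw [map_add, sigmaRho_prod_linearForm hn Complex.I_mul_I s hs,
      sigmaRho_prod_linearForm hn (by simp) s hs]
  · rw [map_add, sigmaPhi_prod_linearForm, sigmaPhi_prod_linearForm, neg_neg, add_comm]
  · rw [map_add, constantCoeff_prod_linearForm _ s hs0, constantCoeff_prod_linearForm _ s hs0,
      add_zero]

theorem polarized_norm_mem_dihedralIdeal (n : ℕ) {k : ℕ} (h i : Fin k) :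
    X ((0 : Fin 2), h) * X ((0 : Fin 2), i) + X ((1 : Fin 2), h) * X ((1 : Fin 2), i) ∈
      dihedralIdeal n k := by
  refine Ideal.subset_span ⟨?_, ?_, ?_⟩
  · have hC : (C (Real.cos (2 * Real.pi / n) : ℂ) ^ 2 + C (Real.sin (2 * Real.pi / n) : ℂ) ^ 2 :
        MvPolynomial (Fin 2 × Fin k) ℂ) = 1 := by
      rw [← C_pow, ← C_pow, ← C_add, ← C_1]
      exact congrArg C (by exact_mod_cast Real.cos_sq_add_sin_sq (2 * Real.pi / n))
    simp only [sigmaRho, map_add, map_mul, aeval_X, smul_eq_C_mul, if_true, one_ne_zero,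
      if_false]
    linear_combination (X (0, h) * X (0, i) + X (1, h) * X (1, i)) * hC
  · simp [sigmaPhi]
  · simp

theorem ideal_elements (n k : ℕ) (hn : 2 ≤ n) (hk : 1 ≤ k) :
    (∀ h i : Fin k, h ≤ i →
      X ((0 : Fin 2), h) * X ((0 : Fin 2), i) + X ((1 : Fin 2), h) * X ((1 : Fin 2), i) ∈
        dihedralIdeal n k) ∧
    (∀ α : Fin k → ℕ, (∑ ℓ, α ℓ) = n →
      (∏ ℓ, X ((0 : Fin 2), ℓ) ^ α ℓ) ∈ dihedralIdeal n k) := by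
  refine ⟨fun h i _ => polarized_norm_mem_dihedralIdeal n h i, fun α hα => ?_⟩
  have h2 : IsUnit (2 : MvPolynomial (Fin 2 × Fin k) ℂ) := by
    have := (isUnit_iff_ne_zero.2 (two_ne_zero (α := ℂ))).map
      (C : ℂ →+* MvPolynomial (Fin 2 × Fin k) ℂ)
    rwa [map_ofNat] at this
  have hpol (a b : Fin k) : linearForm Complex.I a * linearForm (-Complex.I) b +
      linearForm (-Complex.I) a * linearForm Complex.I b ∈ dihedralIdeal n k := by
    have hI : (C Complex.I * C Complex.I : MvPolynomial (Fin 2 × Fin k) ℂ) = -1 := by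
      rw [← C_mul, Complex.I_mul_I, C_neg, C_1]
    convert (dihedralIdeal n k).mul_mem_left 2 (polarized_norm_mem_dihedralIdeal n a b) using 1
    simp only [linearForm, C_neg]
    linear_combination (-2 * X (1, a) * X (1, b)) * hI
  set s : Multiset (Fin k) := ∑ ℓ, α ℓ • {ℓ} with hs
  have hcard : s.card = n := by simp [hs, hα]
  have hprod : (s.map fun ℓ => linearForm Complex.I ℓ + linearForm (-Complex.I) ℓ).prod =
      2 ^ n * ∏ ℓ, X ((0 : Fin 2), ℓ) ^ α ℓ := by
    have hx (ℓ : Fin k) : linearForm Complex.I ℓ + linearForm (-Complex.I) ℓ =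
        2 * X ((0 : Fin 2), ℓ) := by
      simp only [linearForm, C_neg]
      ring
    simp only [hx, Multiset.prod_map_mul, Multiset.map_const', Multiset.prod_replicate, hcard]
    rw [hs, ← Multiset.coe_mapAddMonoidHom, map_sum, Multiset.prod_sum]
    simp [Multiset.map_nsmul, Multiset.prod_nsmul]
  rw [← Ideal.unit_mul_mem_iff_mem _ (h2.pow n), ← hprod, ← sub_add_cancel (Multiset.prod _)]
  exact Ideal.add_mem _
    (prod_add_sub_prod_mem_of_polarized_mem h2 hpol s (by omega))
    (prod_linearForm_add_mem_dihedralIdeal (by omega) s hcard)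
end

section
/- Let n ≥ 1 and k ≥ 1 be integers and let ζ ∈ ℂ be a primitive n-th root of unity. Let σ be the ℂ-algebra endomorphism of MvPolynomial (Fin k) ℂ determined by X i ↦ ζ • X i for every i. Then the ideal generated by { p | σ p = p and constantCoeff p = 0 } equals the ideal generated by the set of monomials { ∏_i X i ^{α_i} | α : Fin k → ℕ, ∑_i α_i = n }. -/
open MvPolynomial

/-- The diagonal action of a generator of the cyclic group ℤ_n on k bosonic
variables, determined by X i ↦ ζ • X i. -/
noncomputable def cyclicSigma (k : ℕ) (ζ : ℂ) :
    MvPolynomial (Fin k) ℂ →ₐ[ℂ] MvPolynomial (Fin k) ℂ :=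
  aeval fun i => ζ • X i

theorem cyclicSigma_monomial {k : ℕ} (ζ : ℂ) (d : Fin k →₀ ℕ) (a : ℂ) :
    cyclicSigma k ζ (monomial d a) = monomial d (ζ ^ d.degree * a) := by
  rw [cyclicSigma, aeval_monomial, monomial_eq, Finsupp.degree_apply, Finsupp.prod, Finsupp.prod]
  simp only [smul_eq_C_mul, mul_pow, Finset.prod_mul_distrib, Finset.prod_pow_eq_pow_sum,
    algebraMap_eq, C_mul, C_pow]
  ring

theorem coeff_cyclicSigma {k : ℕ} (ζ : ℂ) (p : MvPolynomial (Fin k) ℂ) (d : Fin k →₀ ℕ) :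
    coeff d (cyclicSigma k ζ p) = ζ ^ d.degree * coeff d p := by
  induction p using MvPolynomial.induction_on' with
  | monomial e a =>
    rw [cyclicSigma_monomial, coeff_monomial, coeff_monomial]
    split_ifs with h
    · rw [h]
    · rw [mul_zero]
  | add p q hp hq => rw [map_add, coeff_add, coeff_add, hp, hq, mul_add]

theorem monomial_one_eq_prod_X_pow {k : ℕ} (d : Fin k →₀ ℕ) :
    (monomial d 1 : MvPolynomial (Fin k) ℂ) = ∏ i, X i ^ d i := by
  rw [monomial_eq, C_1, one_mul, Finsupp.prod_fintype _ _ fun i => pow_zero _]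

theorem cyclic_invariant_ideal_eq (n k : ℕ) (hn : 1 ≤ n) (hk : 1 ≤ k)
    (ζ : ℂ) (hζ : IsPrimitiveRoot ζ n) :
    Ideal.span { p | cyclicSigma k ζ p = p ∧ constantCoeff p = 0 } =
      Ideal.span { q : MvPolynomial (Fin k) ℂ |
        ∃ α : Fin k → ℕ, (∑ i, α i) = n ∧ q = ∏ i, X i ^ α i } := by
  apply le_antisymm
  · rw [Ideal.span_le]
    rintro p ⟨hp, hp0⟩
    rw [SetLike.mem_coe, p.as_sum]
    refine sum_mem fun d hd => ?_
    rw [mem_support_iff] at hd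
    have hpow : ζ ^ d.degree = 1 := by
      have h := coeff_cyclicSigma ζ p d
      rw [hp] at h
      exact mul_right_cancel₀ hd (by rw [← h, one_mul])
    have hd0 : d.degree ≠ 0 := by
      intro h
      rw [Finsupp.degree_eq_zero_iff] at h
      subst h
      exact hd hp0
    have hle : n ≤ d.degree :=
      Nat.le_of_dvd (Nat.pos_of_ne_zero hd0) (hζ.dvd_of_pow_eq_one _ hpow)
    obtain ⟨e, hed, he⟩ := Finsupp.exists_le_degree_eq d n hle
    have hmul : monomial d (coeff d p) = monomial (d - e) (coeff d p) * monomial e 1 := by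
      rw [monomial_mul, tsub_add_cancel_of_le hed, mul_one]
    rw [hmul]
    refine Ideal.mul_mem_left _ _ (Ideal.subset_span ⟨e, ?_, monomial_one_eq_prod_X_pow e⟩)
    rw [← he, Finsupp.degree_eq_sum]
  · apply Ideal.span_mono
    rintro _ ⟨α, hα, rfl⟩
    have hdeg : (Finsupp.equivFunOnFinite.symm α).degree = n := by
      rw [Finsupp.degree_eq_sum, ← hα]
      rfl
    have hmon : (∏ i, X i ^ α i : MvPolynomial (Fin k) ℂ) =
        monomial (Finsupp.equivFunOnFinite.symm α) 1 :=
      (monomial_one_eq_prod_X_pow (Finsupp.equivFunOnFinite.symm α)).symm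
    rw [hmon]
    refine ⟨by rw [cyclicSigma_monomial, hdeg, hζ.pow_eq_one, one_mul], ?_⟩
    rw [constantCoeff_eq, coeff_monomial, if_neg]
    intro h
    rw [h, map_zero] at hdeg
    omega
end
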